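/- Let E = (E^0, E^1, r, s) be a topological graph with E^0_sce = ∅ (i.e., r(E^1) is dense in E^0). Then for every open set U ⊆ E^* and every compact set K ⊆ E^* satisfying Z(U) ∩ Z(K)^c ≠ ∅, there exists an open subset V of E^* such that ∅ ≠ Z(V) ⊆ Z(U) ∩ Z(K)^c. -/

import Mathlib

/-- A locally compact Hausdorff space is *totally disconnected* (in the sense used for
topological graphs) if it has an open base consisting of compact open subsets. -/
def TotallyDisc (T : Type) [TopologicalSpace T] : Prop :=
  ∀ (t : T) (U : Set T), IsOpen U → t ∈ U →
    ∃ W : Set T, IsCompact W ∧ IsOpen W ∧ t ∈ W ∧ W ⊆ U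

/-- A topological graph `E = (E⁰, E¹, r, s)`: `r` continuous, `s` a local homeomorphism. -/
structure TopGraph (V E : Type) [TopologicalSpace V] [TopologicalSpace E] where
  r : E → V
  s : E → V
  cont_r : Continuous r
  locHomeo_s : IsLocalHomeomorph s

namespace TopGraph

variable {V E : Type} [TopologicalSpace V] [TopologicalSpace E] (G : TopGraph V E)

/-- Compatibility condition for a finite sequence of edges to be a path. -/
def PathCond (n : ℕ) (μ : Fin n → E) : Prop :=
  ∀ (i : ℕ) (h : i + 1 < n), G.s (μ ⟨i, Nat.lt_of_succ_lt h⟩) = G.r (μ ⟨i + 1, h⟩)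

/-- The space `Eⁿ` of paths of length `n`; paths of length `0` are vertices. -/
def PathN : ℕ → Type
  | 0 => V
  | n + 1 => { μ : Fin (n + 1) → E // G.PathCond (n + 1) μ }

instance pathNTop : (n : ℕ) → TopologicalSpace (G.PathN n)
  | 0 => inferInstanceAs (TopologicalSpace V)
  | n + 1 => inferInstanceAs (TopologicalSpace { μ : Fin (n + 1) → E // G.PathCond (n + 1) μ })

/-- The finite path space `E* = ⨿ₙ Eⁿ` with the disjoint union topology. -/
def FinPath : Type := (n : ℕ) × G.PathN n

instance : TopologicalSpace G.FinPath := inferInstanceAs (TopologicalSpace ((n : ℕ) × G.PathN n))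

/-- The range `r(μ)` of a finite path. -/
def pathRange : (n : ℕ) → G.PathN n → V
  | 0, v => v
  | _ + 1, μ => G.r (μ.1 ⟨0, Nat.succ_pos _⟩)

/-- The source `s(μ)` of a finite path. -/
def pathSource : (n : ℕ) → G.PathN n → V
  | 0, v => v
  | n + 1, μ => G.s (μ.1 ⟨n, Nat.lt_succ_self n⟩)

/-- The `i`-th edge of a finite path (`none` if out of range); `0`-indexed. -/
def pathEdge : (n : ℕ) → G.PathN n → ℕ → Option E
  | 0, _, _ => none
  | n + 1, μ, i => if h : i < n + 1 then some (μ.1 ⟨i, h⟩) else none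

/-- `E⁰_sce = E⁰ \ cl (r(E¹))`. -/
def sce : Set V := {v | v ∉ closure (Set.range G.r)}

/-- `E⁰_fin`: vertices with an open neighborhood `N` such that `r⁻¹(cl N)` is compact. -/
def finV : Set V := {v | ∃ N : Set V, IsOpen N ∧ v ∈ N ∧ IsCompact (G.r ⁻¹' closure N)}

/-- `E⁰_rg = E⁰_fin \ cl (E⁰_sce)`. -/
def rg : Set V := G.finV \ closure G.sce

/-- `E⁰_sg = E⁰ \ E⁰_rg`. -/
def sg : Set V := {v | v ∉ G.rg}

/-- The infinite path space `E^∞`. -/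
def InfPath : Type := { μ : ℕ → E // ∀ i : ℕ, G.s (μ i) = G.r (μ (i + 1)) }

/-- The boundary path space `∂E = E^∞ ⨿ {μ ∈ E* : s(μ) ∈ E⁰_sg}`. -/
def BoundaryPath : Type :=
  G.InfPath ⊕ { α : G.FinPath // G.pathSource α.1 α.2 ∈ G.sg }

/-- The finite boundary path determined by a finite path whose source is singular. -/
def mkFin (α : G.FinPath) (h : G.pathSource α.1 α.2 ∈ G.sg) : G.BoundaryPath :=
  Sum.inr ⟨α, h⟩

/-- The length of a boundary path, in `ℕ∞`. -/
def bLen : G.BoundaryPath → ℕ∞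
  | Sum.inl _ => ⊤
  | Sum.inr α => (α.1.1 : ℕ∞)

/-- The `i`-th edge of a boundary path. -/
def bEdge : G.BoundaryPath → ℕ → Option E
  | Sum.inl μ, i => some (μ.1 i)
  | Sum.inr α, i => G.pathEdge α.1.1 α.1.2 i

/-- The range vertex of a boundary path. -/
def bRange : G.BoundaryPath → V
  | Sum.inl μ => G.r (μ.1 0)
  | Sum.inr α => G.pathRange α.1.1 α.1.2

/-- `α ∈ E*` is an initial segment of the boundary path `μ`, i.e. `μ = αβ`. -/
def IsPrefix (α : G.FinPath) (μ : G.BoundaryPath) : Prop :=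
  G.pathRange α.1 α.2 = G.bRange μ ∧
    ∀ i : ℕ, i < α.1 → G.bEdge μ i = G.pathEdge α.1 α.2 i

/-- The cylinder set `Z(S) ⊆ ∂E` of a set `S ⊆ E*`. -/
def cyl (S : Set G.FinPath) : Set G.BoundaryPath :=
  {μ | ∃ α ∈ S, G.IsPrefix α μ}

/-- The topology on `∂E`, generated by the sets `Z(U) ∩ Z(K)ᶜ` with `U` open, `K` compact. -/
instance : TopologicalSpace G.BoundaryPath :=
  TopologicalSpace.generateFrom
    {W | ∃ (U K : Set G.FinPath), IsOpen U ∧ IsCompact K ∧ W = G.cyl U ∩ (G.cyl K)ᶜ}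

/-- Removing the first edge of a path of length `n + 1`. -/
def pathTail : (n : ℕ) → G.PathN (n + 1) → G.PathN n
  | 0, μ => G.s (μ.1 ⟨0, Nat.one_pos⟩)
  | n + 1, μ => ⟨fun i => μ.1 ⟨i.1 + 1, by omega⟩, fun i h => μ.2 (i + 1) (by omega)⟩

theorem pathSource_pathTail : ∀ (n : ℕ) (μ : G.PathN (n + 1)),
    G.pathSource n (G.pathTail n μ) = G.pathSource (n + 1) μ
  | 0, μ => rfl
  | n + 1, μ => rfl

/-- The one-sided shift `σ` on `∂E` (the identity on paths of length `0`,
where it is undefined). -/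
def shift : G.BoundaryPath → G.BoundaryPath
  | Sum.inl μ => Sum.inl ⟨fun i => μ.1 (i + 1), fun i => μ.2 (i + 1)⟩
  | Sum.inr α =>
    match α with
    | ⟨⟨0, v⟩, h⟩ => Sum.inr ⟨⟨0, v⟩, h⟩
    | ⟨⟨n + 1, μ⟩, h⟩ =>
        Sum.inr ⟨⟨n, G.pathTail n μ⟩, by rw [G.pathSource_pathTail]; exact h⟩

/-- The Renault–Deaconu relation of the boundary path groupoid `Γ(∂E, σ)`:
`(μ, n, ν)` is an element of the groupoid. -/
def bRD (μ : G.BoundaryPath) (n : ℤ) (ν : G.BoundaryPath) : Prop :=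
  ∃ k l : ℕ, n = (k : ℤ) - (l : ℤ) ∧ (k : ℕ∞) ≤ G.bLen μ ∧ (l : ℕ∞) ≤ G.bLen ν ∧
    G.shift^[k] μ = G.shift^[l] ν

/-- The boundary path groupoid `Γ(∂E, σ)` as a set of triples. -/
def BPGroupoid : Type :=
  { x : G.BoundaryPath × ℤ × G.BoundaryPath // G.bRD x.1 x.2.1 x.2.2 }

/-- The range map of the boundary path groupoid. -/
def gR (x : G.BPGroupoid) : G.BoundaryPath := x.1.1

/-- The source map of the boundary path groupoid. -/
def gS (x : G.BPGroupoid) : G.BoundaryPath := x.1.2.2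

/-- The topology on `Γ(∂E, σ)` generated by the basic open sets `𝒰(U, V, k, l)`. -/
instance : TopologicalSpace G.BPGroupoid :=
  TopologicalSpace.generateFrom
    {W | ∃ (U Vs : Set G.BoundaryPath) (k l : ℕ),
      IsOpen U ∧ IsOpen Vs ∧
      (∀ μ ∈ U, (k : ℕ∞) ≤ G.bLen μ) ∧ (∀ μ ∈ Vs, (l : ℕ∞) ≤ G.bLen μ) ∧
      Set.InjOn (G.shift^[k]) U ∧ Set.InjOn (G.shift^[l]) Vs ∧
      W = {x : G.BPGroupoid | G.gR x ∈ U ∧ G.gS x ∈ Vs ∧ x.1.2.1 = (k : ℤ) - (l : ℤ) ∧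
        G.shift^[k] (G.gR x) = G.shift^[l] (G.gS x)}}

/-- A unit `μ ∈ ∂E` has trivial isotropy in `Γ(∂E, σ)`. -/
def TrivialIsotropy (μ : G.BoundaryPath) : Prop :=
  ∀ n : ℤ, G.bRD μ n μ → n = 0

/-- `E` is essentially free: the units with trivial isotropy are dense in `∂E`. -/
def EssentiallyFree : Prop := Dense {μ : G.BoundaryPath | G.TrivialIsotropy μ}

/-- `N ⊆ Γ(∂E, σ)` is a bisection: the source and range maps restrict to homeomorphisms
of `N` onto their images. -/
def IsBisection (N : Set G.BPGroupoid) : Prop :=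
  Topology.IsEmbedding (N.restrict G.gS) ∧ Topology.IsEmbedding (N.restrict G.gR)

/-- The boundary path groupoid `Γ(∂E, σ)` is locally contracting
(Anantharaman-Delaroche): for every nonempty open `U` in the unit space `∂E` there are an
open `V ⊆ U` and an open bisection `N` with `cl V ⊆ s(N)` and
`s((r|_{N⁻¹})⁻¹(cl V)) ⊊ V`. -/
def BPLocallyContracting : Prop :=
  ∀ U : Set G.BoundaryPath, IsOpen U → U.Nonempty →
    ∃ (Vs : Set G.BoundaryPath) (N : Set G.BPGroupoid),
      IsOpen Vs ∧ Vs ⊆ U ∧ IsOpen N ∧ G.IsBisection N ∧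
      closure Vs ⊆ G.gS '' N ∧
      G.gR '' (N ∩ {x | G.gS x ∈ closure Vs}) ⊂ Vs

/-- `μ` is a cycle: a path of length `n + 1 ≥ 1` with `r(μ) = s(μ)`. -/
def IsCycle (n : ℕ) (μ : G.PathN (n + 1)) : Prop :=
  G.pathRange (n + 1) μ = G.pathSource (n + 1) μ

/-- The cycle `μ` has no entrances: `r⁻¹(r(μᵢ)) = {μᵢ}` for all `i`. -/
def NoEntrances (n : ℕ) (μ : G.PathN (n + 1)) : Prop :=
  ∀ (i : Fin (n + 1)) (e : E), G.r e = G.r (μ.1 i) → e = μ.1 i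

/-- The cycle `μ` has entrances. -/
def HasEntrances (n : ℕ) (μ : G.PathN (n + 1)) : Prop := ¬ G.NoEntrances n μ

/-- `E` is topologically free: the set of base points of cycles without entrances has
empty interior. -/
def TopologicallyFree : Prop :=
  interior {v : V | ∃ (n : ℕ) (μ : G.PathN (n + 1)),
    G.IsCycle n μ ∧ G.NoEntrances n μ ∧ G.pathRange (n + 1) μ = v} = ∅

/-- The positive orbit space `Orb⁺(v)` of a vertex. -/
def orb (v : V) : Set V :=
  {w | ∃ (n : ℕ) (ν : G.PathN n), G.pathRange n ν = w ∧ G.pathSource n ν = v}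

/-- `Orb⁺(r(μ)) ∪ ⋃ᵢ Orb⁺(s(μᵢ))` for a boundary path `μ`. -/
def cofinalSet (μ : G.BoundaryPath) : Set V :=
  G.orb (G.bRange μ) ∪ {w | ∃ (i : ℕ) (e : E), G.bEdge μ i = some e ∧ w ∈ G.orb (G.s e)}

/-- `E` is cofinal. -/
def Cofinal : Prop := ∀ μ : G.BoundaryPath, Dense (G.cofinalSet μ)

/-- Every open neighborhood `N` of `μ` in `E^{|μ|}` contains an open neighborhood `U` of
`μ` with `r^{|μ|}(U) ⊆ s^{|μ|}(U)`. -/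
def NbhdContracting (n : ℕ) (μ : G.PathN (n + 1)) : Prop :=
  ∀ N : Set (G.PathN (n + 1)), IsOpen N → μ ∈ N →
    ∃ U : Set (G.PathN (n + 1)), IsOpen U ∧ μ ∈ U ∧ U ⊆ N ∧
      G.pathRange (n + 1) '' U ⊆ G.pathSource (n + 1) '' U

/-- The set `B` of vertices which connect to a cycle `μ` with entrances such that every
open neighborhood of `μ` contains an open neighborhood `U` of `μ` with
`r^{|μ|}(U) ⊆ s^{|μ|}(U)`. -/
def Bset : Set V :=
  {v | ∃ (n : ℕ) (μ : G.PathN (n + 1)), G.IsCycle n μ ∧ G.HasEntrances n μ ∧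
    v ∈ G.orb (G.pathRange (n + 1) μ) ∧ G.NbhdContracting n μ}

/-- Truncation of a path of length `n + 1` to its first `m + 1` edges (`m ≤ n`). -/
def pathTrunc (m n : ℕ) (h : m ≤ n) (μ : G.PathN (n + 1)) : G.PathN (m + 1) :=
  ⟨fun i => μ.1 ⟨i.1, by omega⟩, fun i hi => μ.2 i (by omega)⟩

/-- The conditions on a finite family `{Uᵢ ⊆ E^{nᵢ+1}}` witnessing that `Vset` is a
contracting open set in the sense of Katsura. -/
def ContractingWitness (Vset : Set V) (k : ℕ) (nf : Fin k → ℕ)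
    (U : ∀ i : Fin k, Set (G.PathN (nf i + 1))) : Prop :=
  (∀ i, (U i).Nonempty ∧ IsOpen (U i)) ∧
  (∀ i, ∀ μ ∈ U i, G.pathRange (nf i + 1) μ ∈ Vset) ∧
  (∀ i j, i ≠ j → ∀ h : nf i ≤ nf j, ∀ μ ∈ U j, G.pathTrunc (nf i) (nf j) h μ ∉ U i) ∧
  closure Vset ⊂ ⋃ i, (G.pathSource (nf i + 1)) '' U i

/-- `Vset ⊆ E⁰` is a contracting open set in the sense of Katsura. -/
def IsContractingSet (Vset : Set V) : Prop :=
  Vset.Nonempty ∧ IsOpen Vset ∧ IsCompact (closure Vset) ∧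
    ∃ (k : ℕ) (nf : Fin k → ℕ) (U : ∀ i : Fin k, Set (G.PathN (nf i + 1))),
      G.ContractingWitness Vset k nf U

/-- `E` is contracting at the vertex `v`. -/
def ContractingAt (v : V) : Prop :=
  Dense (G.orb v) ∧ ∀ N : Set V, IsOpen N → v ∈ N →
    ∃ W : Set V, W ⊆ N ∧ G.IsContractingSet W

/-- `E` is a contracting topological graph. -/
def Contracting : Prop := ∃ v : V, G.ContractingAt v

end TopGraph

namespace TopGraph

variable {V E : Type} [TopologicalSpace V] [TopologicalSpace E] (G : TopGraph V E)

/-- The finite path `α` is an initial segment of the finite path `β`. -/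
def IsInitial (α β : G.FinPath) : Prop :=
  α.1 ≤ β.1 ∧ G.pathRange α.1 α.2 = G.pathRange β.1 β.2 ∧
    ∀ i < α.1, G.pathEdge β.1 β.2 i = G.pathEdge α.1 α.2 i

variable {G}

theorem IsInitial.refl (α : G.FinPath) : G.IsInitial α α :=
  ⟨le_rfl, rfl, fun _ _ => rfl⟩

theorem IsInitial.trans {α β γ : G.FinPath} (h : G.IsInitial α β) (h' : G.IsInitial β γ) :
    G.IsInitial α γ :=
  ⟨h.1.trans h'.1, h.2.1.trans h'.2.1, fun i hi =>
    (h'.2.2 i (hi.trans_le h.1)).trans (h.2.2 i hi)⟩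

theorem IsInitial.of_le {α β γ : G.FinPath} (h : G.IsInitial α γ) (h' : G.IsInitial β γ)
    (hle : α.1 ≤ β.1) : G.IsInitial α β :=
  ⟨hle, h.2.1.trans h'.2.1.symm, fun i hi =>
    (h'.2.2 i (hi.trans_le hle)).symm.trans (h.2.2 i hi)⟩

theorem IsInitial.isPrefix {α β : G.FinPath} {x : G.BoundaryPath} (h : G.IsInitial α β)
    (h' : G.IsPrefix β x) : G.IsPrefix α x :=
  ⟨h.2.1.trans h'.1, fun i hi => (h'.2 i (hi.trans_le h.1)).trans (h.2.2 i hi)⟩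

theorem IsPrefix.isInitial {α β : G.FinPath} {x : G.BoundaryPath} (h : G.IsPrefix α x)
    (h' : G.IsPrefix β x) (hle : α.1 ≤ β.1) : G.IsInitial α β :=
  ⟨hle, h.1.trans h'.1.symm, fun i hi => (h'.2 i (hi.trans_le hle)).symm.trans (h.2 i hi)⟩

variable (G)

theorem pathEdge_of_lt {n i : ℕ} (μ : G.PathN n) (hi : i < n) :
    ∃ e, G.pathEdge n μ i = some e := by
  cases n with
  | zero => omega
  | succ n => exact ⟨_, dif_pos hi⟩

theorem lt_of_pathEdge {n i : ℕ} {μ : G.PathN n} {e : E} (h : G.pathEdge n μ i = some e) :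
    i < n := by
  cases n with
  | zero => simp [pathEdge] at h
  | succ n =>
    by_contra hi
    simp [pathEdge, hi] at h

theorem s_eq_r_of_pathEdge {n i : ℕ} {μ : G.PathN n} {e e' : E}
    (h : G.pathEdge n μ i = some e) (h' : G.pathEdge n μ (i + 1) = some e') :
    G.s e = G.r e' := by
  have hi := G.lt_of_pathEdge h'
  cases n with
  | zero => omega
  | succ n =>
    rw [pathEdge, dif_pos (by omega), Option.some.injEq] at h h'
    rw [← h, ← h']
    exact μ.2 i hi

theorem pathRange_of_pathEdge {n : ℕ} {μ : G.PathN n} {e : E}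
    (h : G.pathEdge n μ 0 = some e) : G.pathRange n μ = G.r e := by
  have hi := G.lt_of_pathEdge h
  cases n with
  | zero => omega
  | succ n =>
    rw [pathEdge, dif_pos (by omega), Option.some.injEq] at h
    rw [← h]
    rfl

theorem pathN_ext {n : ℕ} {μ ν : G.PathN n} (hr : G.pathRange n μ = G.pathRange n ν)
    (he : ∀ i < n, G.pathEdge n μ i = G.pathEdge n ν i) : μ = ν := by
  cases n with
  | zero => exact hr
  | succ n =>
    refine Subtype.ext (funext fun i => ?_)
    simpa [pathEdge, i.2] using he i i.2

/-- The initial segment of length `k` of a path of length `n`. -/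
def pathInit : (k n : ℕ) → k ≤ n → G.PathN n → G.PathN k
  | 0, n, _, μ => G.pathRange n μ
  | k + 1, n + 1, h, μ => G.pathTrunc k n (Nat.le_of_succ_le_succ h) μ

theorem pathInit_isInitial (k n : ℕ) (h : k ≤ n) (μ : G.PathN n) :
    G.IsInitial ⟨k, G.pathInit k n h μ⟩ ⟨n, μ⟩ := by
  refine ⟨h, ?_, fun i hi => ?_⟩
  · cases k with
    | zero => rfl
    | succ k => cases n with
      | zero => omega
      | succ n => rfl
  · dsimp only at hi
    cases k with
    | zero => omega
    | succ k => cases n with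
      | zero => omega
      | succ n => simp [pathEdge, hi, hi.trans_le h, pathInit, pathTrunc]

theorem IsInitial.eq_pathInit {k n : ℕ} {α : G.PathN k} {μ : G.PathN n}
    (h : G.IsInitial ⟨k, α⟩ ⟨n, μ⟩) : α = G.pathInit k n h.1 μ := by
  have h' := h.of_le (G.pathInit_isInitial k n h.1 μ) le_rfl
  exact G.pathN_ext h'.2.1 fun i hi => (h'.2.2 i hi).symm

theorem continuous_edge (n : ℕ) (i : Fin (n + 1)) :
    Continuous fun μ : G.PathN (n + 1) => μ.1 i :=
  (continuous_apply (A := fun _ => E) i).comp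
    (continuous_subtype_val (p := fun μ => G.PathCond (n + 1) μ))

theorem continuous_pathRange (n : ℕ) : Continuous (G.pathRange n) := by
  cases n with
  | zero => exact continuous_id
  | succ n => exact G.cont_r.comp (G.continuous_edge n _)

theorem continuous_pathInit (k n : ℕ) (h : k ≤ n) : Continuous (G.pathInit k n h) := by
  cases k with
  | zero => exact G.continuous_pathRange n
  | succ k => cases n with
    | zero => omega
    | succ n =>
      exact Continuous.subtype_mk (continuous_pi fun _ => G.continuous_edge n _) _

theorem exists_pathInit_eq (n : ℕ) (β : G.PathN n) (e : E) (h : G.pathSource n β = G.r e) :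
    ∃ γ : G.PathN (n + 1), G.pathInit n (n + 1) n.le_succ γ = β ∧ γ.1 (Fin.last n) = e := by
  cases n with
  | zero => exact ⟨⟨fun _ => e, fun i (hi : i + 1 < 1) => by omega⟩, h.symm, rfl⟩
  | succ n =>
    refine ⟨⟨Fin.snoc (α := fun _ => E) β.1 e, fun i hi => ?_⟩, ?_, ?_⟩
    · rcases Nat.lt_or_ge (i + 1) (n + 1) with hlt | hge
      · have := β.2 i hlt
        simpa [Fin.snoc, hlt, Nat.lt_of_succ_lt hlt] using this
      · obtain rfl : i = n := by omega
        simpa [Fin.snoc, pathSource] using h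
    · refine Subtype.ext (funext fun i => ?_)
      exact Fin.snoc_castSucc (α := fun _ => E) e β.1 i
    · exact Fin.snoc_last (α := fun _ => E) _ _

theorem pathSource_pathInit (n : ℕ) (μ : G.PathN (n + 1)) :
    G.pathSource n (G.pathInit n (n + 1) n.le_succ μ) = G.r (μ.1 (Fin.last n)) := by
  cases n with
  | zero => rfl
  | succ n => exact μ.2 n (by omega)

theorem comap_pathInit_inf_comap_last_le (n : ℕ) (μ : G.PathN (n + 1)) :
    (nhds (G.pathInit n (n + 1) n.le_succ μ)).comap (G.pathInit n (n + 1) n.le_succ) ⊓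
      (nhds (μ.1 (Fin.last n))).comap (fun ν : G.PathN (n + 1) => ν.1 (Fin.last n)) ≤
    nhds μ := by
  refine le_of_le_of_eq ?_ (nhds_subtype_eq_comap (x := μ.1) (h := μ.2)).symm
  refine Filter.tendsto_iff_comap.1 (tendsto_pi_nhds.2 ?_)
  intro i
  rcases eq_or_ne i (Fin.last n) with rfl | hi
  · exact Filter.tendsto_comap.mono_left inf_le_right
  · cases n with
    | zero => exact absurd (Fin.ext (by simp)) hi
    | succ n =>
      have hlt : i.1 < n + 1 := Fin.val_lt_last hi
      have hc : Continuous fun ν : G.PathN (n + 1) => ν.1 ⟨i.1, hlt⟩ :=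
        G.continuous_edge n _
      exact ((hc.tendsto _).comp Filter.tendsto_comap).mono_left inf_le_left

theorem image_pathSource_mem_nhds (n : ℕ) (μ : G.PathN n) {Y : Set (G.PathN n)}
    (hY : Y ∈ nhds μ) : G.pathSource n '' Y ∈ nhds (G.pathSource n μ) := by
  induction n with
  | zero =>
    have : G.pathSource 0 '' Y = Y := Set.image_id Y
    rw [this]
    exact hY
  | succ n ih =>
    obtain ⟨A', ⟨A, hA, hAA'⟩, B', ⟨B, hB, hBB'⟩, rfl⟩ :=
      Filter.mem_inf_iff.1 (G.comap_pathInit_inf_comap_last_le n μ hY)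
    have hsA := ih _ hA
    rw [G.pathSource_pathInit] at hsA
    have hs := G.locHomeo_s.isOpenMap.image_mem_nhds
      (Filter.inter_mem hB (G.cont_r.continuousAt hsA))
    refine Filter.mem_of_superset hs ?_
    rintro _ ⟨e, ⟨heB, β, hβA, hβ⟩, rfl⟩
    obtain ⟨γ, rfl, rfl⟩ := G.exists_pathInit_eq n β e hβ
    exact ⟨γ, ⟨hAA' hβA, hBB' heB⟩, rfl⟩

theorem mem_sg_iff (hsce : G.sce = ∅) (v : V) : v ∈ G.sg ↔ v ∉ G.finV := by
  simp [sg, rg, hsce]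

theorem exists_r_eq [T2Space V] (hsce : G.sce = ∅) {v : V} (hv : v ∉ G.sg) :
    ∃ e, G.r e = v := by
  rw [G.mem_sg_iff hsce, not_not] at hv
  obtain ⟨N, hN, hvN, hc⟩ := hv
  have hd : v ∈ closure (Set.range G.r) := by
    by_contra h
    exact (hsce ▸ h : v ∈ (∅ : Set V))
  have hcl : IsClosed (G.r '' (G.r ⁻¹' closure N)) := (hc.image G.cont_r).isClosed
  have hmem : v ∈ closure (N ∩ Set.range G.r) := hN.inter_closure ⟨hvN, hd⟩
  have hsub : N ∩ Set.range G.r ⊆ G.r '' (G.r ⁻¹' closure N) := by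
    rintro _ ⟨hw, e, rfl⟩
    exact ⟨e, subset_closure hw, rfl⟩
  obtain ⟨e, -, he⟩ := closure_minimal hsub hcl hmem
  exact ⟨e, he⟩

theorem exists_boundaryPath [T2Space V] (hsce : G.sce = ∅) (α : G.FinPath) :
    ∃ x : G.BoundaryPath, G.IsPrefix α x := by
  by_cases hex : ∃ β : G.FinPath, G.IsInitial α β ∧ G.pathSource β.1 β.2 ∈ G.sg
  · obtain ⟨β, h, hβ⟩ := hex
    exact ⟨G.mkFin β hβ, h.2⟩
  push Not at hex
  have step (β : {β : G.FinPath // G.IsInitial α β}) :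
      ∃ γ : {β : G.FinPath // G.IsInitial α β},
        G.IsInitial β.1 γ.1 ∧ γ.1.1 = β.1.1 + 1 := by
    obtain ⟨e, he⟩ := G.exists_r_eq hsce (hex β.1 β.2)
    obtain ⟨γ, hγ, -⟩ := G.exists_pathInit_eq _ _ e he.symm
    have hi := G.pathInit_isInitial _ _ (Nat.le_succ _) γ
    rw [hγ] at hi
    exact ⟨⟨⟨_, γ⟩, β.2.trans hi⟩, hi, rfl⟩
  choose f hf hf1 using step
  let b (k : ℕ) := f^[k] ⟨α, IsInitial.refl α⟩
  have hb (k : ℕ) : b (k + 1) = f (b k) := Function.iterate_succ_apply' _ _ _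
  have hlen (k : ℕ) : (b k).1.1 = α.1 + k := by
    induction k with
    | zero => rfl
    | succ k ih => rw [hb, hf1, ih]; omega
  have hnext (k : ℕ) : G.IsInitial (b k).1 (b (k + 1)).1 := hb k ▸ hf (b k)
  have hedge (i : ℕ) : ∃ e, G.pathEdge _ (b (i + 1)).1.2 i = some e :=
    G.pathEdge_of_lt _ (by rw [hlen]; omega)
  choose x hx using hedge
  refine ⟨Sum.inl ⟨x, fun i => ?_⟩, ?_, fun i hi => ?_⟩
  · refine G.s_eq_r_of_pathEdge ?_ (hx (i + 1))
    rw [(hnext (i + 1)).2.2 i (G.lt_of_pathEdge (hx i)), hx]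
  · exact (b 1).2.2.1.trans (G.pathRange_of_pathEdge (hx 0))
  · exact (hx i).symm.trans ((b (i + 1)).2.2.2 i hi)

instance [T2Space V] [T2Space E] : (n : ℕ) → T2Space (G.PathN n)
  | 0 => inferInstanceAs (T2Space V)
  | n + 1 => inferInstanceAs (T2Space { μ : Fin (n + 1) → E // G.PathCond (n + 1) μ })

instance [T2Space V] [T2Space E] : T2Space G.FinPath :=
  inferInstanceAs (T2Space ((n : ℕ) × G.PathN n))

theorem isOpen_setOf_exists_isInitial {U : Set G.FinPath} (hU : IsOpen U) (m : ℕ) :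
    IsOpen {β : G.PathN m | ∃ α ∈ U, G.IsInitial α ⟨m, β⟩} := by
  have : {β : G.PathN m | ∃ α ∈ U, G.IsInitial α ⟨m, β⟩} =
      ⋃ (k : ℕ) (h : k ≤ m), G.pathInit k m h ⁻¹' (Sigma.mk k ⁻¹' U) := by
    ext β
    simp only [Set.mem_ofPred_eq, Set.mem_iUnion, Set.mem_preimage]
    constructor
    · rintro ⟨⟨k, α⟩, hα, h⟩
      refine ⟨k, h.1, ?_⟩
      rwa [← h.eq_pathInit]
    · rintro ⟨k, h, hk⟩
      exact ⟨_, hk, G.pathInit_isInitial k m h β⟩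
  rw [this]
  exact isOpen_iUnion fun k => isOpen_iUnion fun h =>
    (isOpen_sigma_iff.1 hU k).preimage (G.continuous_pathInit k m h)

theorem isClosed_setOf_exists_isInitial {K : Set G.FinPath} (hK : IsClosed K) (m : ℕ) :
    IsClosed {β : G.PathN m | ∃ α ∈ K, G.IsInitial α ⟨m, β⟩} := by
  have : {β : G.PathN m | ∃ α ∈ K, G.IsInitial α ⟨m, β⟩} =
      ⋃ k : Fin (m + 1), G.pathInit k m (Nat.le_of_lt_succ k.2) ⁻¹' (Sigma.mk k.1 ⁻¹' K) := by
    ext β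
    simp only [Set.mem_ofPred_eq, Set.mem_iUnion, Set.mem_preimage]
    constructor
    · rintro ⟨⟨k, α⟩, hα, h⟩
      refine ⟨⟨k, Nat.lt_succ_of_le h.1⟩, ?_⟩
      rwa [← h.eq_pathInit]
    · rintro ⟨k, hk⟩
      exact ⟨_, hk, G.pathInit_isInitial k m _ β⟩
  rw [this]
  exact isClosed_iUnion_of_finite fun k =>
    (isClosed_sigma_iff.1 hK k).preimage (G.continuous_pathInit k m _)

theorem exists_length_le {K : Set G.FinPath} (hK : IsCompact K) :
    ∃ M : ℕ, ∀ α ∈ K, α.1 ≤ M := by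
  have hc : Continuous (Sigma.fst : G.FinPath → ℕ) :=
    continuous_sigma fun _ => continuous_const
  obtain ⟨M, hM⟩ := (hK.image hc).bddAbove
  exact ⟨M, fun α hα => hM ⟨α, hα, rfl⟩⟩

theorem exists_isCompact_pathEdge_mem {K : Set G.FinPath} (hK : IsCompact K) (m : ℕ) :
    ∃ C : Set E, IsCompact C ∧ ∀ α ∈ K, ∀ e, G.pathEdge α.1 α.2 m = some e → e ∈ C := by
  obtain ⟨M, hM⟩ := G.exists_length_le hK
  refine ⟨⋃ n : Fin M, ⋃ h : m < n.1 + 1,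
    (fun μ : G.PathN (n.1 + 1) => μ.1 ⟨m, h⟩) '' (Sigma.mk (n.1 + 1) ⁻¹' K), ?_, ?_⟩
  · refine isCompact_iUnion fun n => isCompact_iUnion fun h => ?_
    refine IsCompact.image ?_ (G.continuous_edge n _)
    exact Topology.IsClosedEmbedding.sigmaMk.isCompact_preimage hK
  · rintro ⟨n, α⟩ hα e he
    have hm := G.lt_of_pathEdge he
    have hn := hM _ hα
    dsimp only at hm hn
    cases n with
    | zero => omega
    | succ n =>
      refine Set.mem_iUnion₂.2 ⟨⟨n, hn⟩, hm, α, hα, ?_⟩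
      simpa [pathEdge, hm] using he

theorem exists_isPrefix_inl (x : G.InfPath) (n : ℕ) :
    ∃ β : G.PathN n, G.IsPrefix ⟨n, β⟩ (Sum.inl x) := by
  cases n with
  | zero => exact ⟨G.r (x.1 0), rfl, fun i hi => absurd hi i.not_lt_zero⟩
  | succ n =>
    refine ⟨⟨fun i => x.1 i, fun i _ => x.2 i⟩, rfl, fun i hi => ?_⟩
    simp_all [bEdge, pathEdge]

theorem length_le_of_isPrefix_inr {α : G.FinPath}
    {μ : { α : G.FinPath // G.pathSource α.1 α.2 ∈ G.sg }}
    (h : G.IsPrefix α (Sum.inr μ)) : α.1 ≤ μ.1.1 := by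
  by_contra hlt
  rw [not_le] at hlt
  obtain ⟨e, he⟩ := G.pathEdge_of_lt α.2 hlt
  exact lt_irrefl _ (G.lt_of_pathEdge ((h.2 _ hlt).trans he))

end TopGraph

/-- Lemma 3.2: if `E⁰_sce = ∅` then for every open `U ⊆ E*` and compact
`K ⊆ E*` with `Z(U) ∩ Z(K)ᶜ ≠ ∅` there is an open `W ⊆ E*` with
`∅ ≠ Z(W) ⊆ Z(U) ∩ Z(K)ᶜ`. -/
theorem TopGraph.technical_lemma_two {V E : Type}
    [TopologicalSpace V] [TopologicalSpace E]
    [SecondCountableTopology V] [SecondCountableTopology E]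
    [LocallyCompactSpace V] [LocallyCompactSpace E] [T2Space V] [T2Space E]
    (G : TopGraph V E) (hsce : G.sce = ∅)
    (U K : Set G.FinPath) (hU : IsOpen U) (hK : IsCompact K)
    (hne : (G.cyl U ∩ (G.cyl K)ᶜ).Nonempty) :
    ∃ W : Set G.FinPath, IsOpen W ∧ (G.cyl W).Nonempty ∧
      G.cyl W ⊆ G.cyl U ∩ (G.cyl K)ᶜ := by
  obtain ⟨x, ⟨α₀, hα₀U, hα₀⟩, hxK⟩ := hne
  have hY (m : ℕ) : IsOpen ({β : G.PathN m | ∃ α ∈ U, G.IsInitial α ⟨m, β⟩} \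
      {β : G.PathN m | ∃ α ∈ K, G.IsInitial α ⟨m, β⟩}) :=
    (G.isOpen_setOf_exists_isInitial hU m).sdiff
      (G.isClosed_setOf_exists_isInitial hK.isClosed m)
  rcases x with x | ⟨⟨m, μ⟩, hμ⟩
  · obtain ⟨M, hM⟩ := G.exists_length_le hK
    obtain ⟨β, hβ⟩ := G.exists_isPrefix_inl x (max M α₀.1)
    refine ⟨Sigma.mk (max M α₀.1) '' _, isOpenMap_sigmaMk _ (hY _),
      ⟨Sum.inl x, _, ⟨β, ⟨⟨α₀, hα₀U, hα₀.isInitial hβ (le_max_right _ _)⟩, ?_⟩, rfl⟩, hβ⟩, ?_⟩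
    · rintro ⟨α, hα, h⟩
      exact hxK ⟨α, hα, h.isPrefix hβ⟩
    · rintro y ⟨_, ⟨γ, ⟨⟨α, hα, h⟩, hγK⟩, rfl⟩, hy⟩
      refine ⟨⟨α, hα, h.isPrefix hy⟩, ?_⟩
      rintro ⟨κ, hκ, hκy⟩
      exact hγK ⟨κ, hκ, hκy.isInitial hy ((hM κ hκ).trans (le_max_left _ _))⟩
  · have hpre : G.IsPrefix ⟨m, μ⟩ (Sum.inr ⟨⟨m, μ⟩, hμ⟩) := ⟨rfl, fun _ _ => rfl⟩
    obtain ⟨C, hC, hCK⟩ := G.exists_isCompact_pathEdge_mem hK m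
    have hmem := (hY m).mem_nhds (x := μ)
      ⟨⟨α₀, hα₀U, hα₀.isInitial hpre (G.length_le_of_isPrefix_inr hα₀)⟩,
        fun ⟨α, hα, h⟩ => hxK ⟨α, hα, h.isPrefix hpre⟩⟩
    obtain ⟨t, ht, htc, hts⟩ :=
      exists_mem_nhds_isClosed_subset (G.image_pathSource_mem_nhds m μ hmem)
    obtain ⟨e, het, heC⟩ : ∃ e, G.r e ∈ closure (interior t) ∧ e ∉ C := by
      by_contra! hsub
      refine (G.mem_sg_iff hsce _).1 hμ
        ⟨interior t, isOpen_interior, mem_interior_iff_mem_nhds.2 ht, ?_⟩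
      exact hC.of_isClosed_subset (isClosed_closure.preimage G.cont_r) hsub
    obtain ⟨β, hβ, hβe⟩ := hts (closure_minimal interior_subset htc het)
    obtain ⟨γ, rfl, rfl⟩ := G.exists_pathInit_eq m β e hβe
    obtain ⟨y, hy⟩ := G.exists_boundaryPath hsce ⟨m + 1, γ⟩
    refine ⟨Sigma.mk (m + 1) '' _, isOpenMap_sigmaMk _
      (((hY m).preimage (G.continuous_pathInit m (m + 1) m.le_succ)).inter
        (hC.isClosed.isOpen_compl.preimage (G.continuous_edge m (Fin.last m)))),
      ⟨y, _, ⟨γ, ⟨hβ, heC⟩, rfl⟩, hy⟩, ?_⟩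
    rintro z ⟨_, ⟨ν, ⟨⟨⟨α, hα, h⟩, hνK⟩, hνC⟩, rfl⟩, hz⟩
    have hz' := (G.pathInit_isInitial m (m + 1) m.le_succ ν).isPrefix hz
    refine ⟨⟨α, hα, h.isPrefix hz'⟩, ?_⟩
    rintro ⟨κ, hκ, hκz⟩
    rcases Nat.lt_or_ge m κ.1 with hlt | hle
    · refine hνC (hCK κ hκ _ ?_)
      rw [← hκz.2 m hlt, hz.2 m m.lt_succ_self]
      exact dif_pos m.lt_succ_self
    · exact hνK ⟨κ, hκ, hκz.isInitial hz' hle⟩
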